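/- Central limit theorem for the lowest bifurcation ratio (Wang–Waymire): on the random model, the random variables √n·(S_{2,n}/n − 1/4) converge in distribution, as n → ∞, to the normal distribution N(0, 1/16). -/

import Mathlib

open MeasureTheory ProbabilityTheory Filter
open scoped NNReal Topology

/-- Binary trees: every internal node has exactly two children. -/
inductive BinTree : Type
  | leaf : BinTree
  | node : BinTree → BinTree → BinTree
  deriving DecidableEq

namespace BinTree

/-- The magnitude of a binary tree is its number of leaves. -/
def magnitude : BinTree → ℕ
  | leaf => 1
  | node l r => magnitude l + magnitude r

/-- The Horton–Strahler order of (the root of) a binary tree: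
leaves have order 1; a node whose two children have distinct orders has the max of the two;
a node whose two children have equal order `r` has order `r + 1`. -/
def ord : BinTree → ℕ
  | leaf => 1
  | node l r => if ord l = ord r then ord l + 1 else max (ord l) (ord r)

/-- `branches k τ` is `S_{k,n}(τ)`, the number of Horton–Strahler branches of order `k`
in `τ`, i.e. the number of maximal connected paths of nodes of order `k`.  It counts the
nodes of order `k` that head a branch: a new branch head of order `ord l + 1` is created
exactly at a node whose two children have equal order `ord l`, and every leaf heads an
order-1 branch. -/
def branches (k : ℕ) : BinTree → ℕ
  | leaf => if k = 1 then 1 else 0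
  | node l r => branches k l + branches k r +
      (if ord l = ord r ∧ ord l + 1 = k then 1 else 0)

end BinTree

/-- `treesOf n` is the finite set `Ω_n` of binary trees of magnitude `n`. -/
def treesOf : ℕ → Finset BinTree
  | 0 => ∅
  | 1 => {BinTree.leaf}
  | (n+2) => (Finset.range (n+1)).attach.biUnion fun k =>
      ((treesOf (k.1+1)) ×ˢ (treesOf (n+1-k.1))).image fun p => BinTree.node p.1 p.2
  decreasing_by
  · have := Finset.mem_range.mp k.2; omega
  · omega

/-- Expectation `⟨f⟩` under the uniform probability measure `P_n` on `Ω_n` (the random model). -/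
noncomputable def expect (n : ℕ) (f : BinTree → ℝ) : ℝ :=
  (∑ τ ∈ treesOf n, f τ) / (treesOf n).card

namespace BinTree

lemma one_le_magnitude (τ : BinTree) : 1 ≤ τ.magnitude := by
  induction τ with
  | leaf => simp [magnitude]
  | node l r hl hr => simp only [magnitude]; omega

lemma one_le_ord (τ : BinTree) : 1 ≤ τ.ord := by
  induction τ with
  | leaf => simp [ord]
  | node l r hl hr =>
    simp only [ord]
    split_ifs
    · omega
    · exact le_max_of_le_left hl

lemma ord_eq_one_iff (τ : BinTree) : τ.ord = 1 ↔ τ.magnitude = 1 := by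
  cases τ with
  | leaf => simp [ord, magnitude]
  | node l r =>
    have := one_le_ord l
    have := one_le_ord r
    have := one_le_magnitude l
    have := one_le_magnitude r
    simp only [ord, magnitude]
    split_ifs <;> omega

lemma branches_two_node (l r : BinTree) :
    branches 2 (node l r) =
      branches 2 l + branches 2 r + if (node l r).magnitude = 2 then 1 else 0 := by
  have h : (ord l = ord r ∧ ord l + 1 = 2) ↔ (node l r).magnitude = 2 := by
    have hl := ord_eq_one_iff l
    have hr := ord_eq_one_iff r
    have := one_le_magnitude l
    have := one_le_magnitude r
    simp only [magnitude]
    omega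
  simp only [branches, h]

lemma branches_two_le_magnitude (τ : BinTree) : branches 2 τ ≤ τ.magnitude := by
  suffices h : branches 2 τ + (if τ.magnitude = 1 then 1 else 0) ≤ τ.magnitude by omega
  induction τ with
  | leaf => simp [branches, magnitude]
  | node l r hl hr =>
    rw [branches_two_node]
    have := one_le_magnitude l
    have := one_le_magnitude r
    simp only [magnitude]
    grind

end BinTree

lemma mem_treesOf {n : ℕ} {τ : BinTree} : τ ∈ treesOf n ↔ τ.magnitude = n := by
  induction n using Nat.strong_induction_on generalizing τ with
  | _ n ih =>
    match n with
    | 0 => simpa [treesOf] using Nat.one_le_iff_ne_zero.mp (BinTree.one_le_magnitude τ)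
    | 1 =>
      cases τ with
      | leaf => simp [treesOf, BinTree.magnitude]
      | node l r =>
        have := BinTree.one_le_magnitude l
        have := BinTree.one_le_magnitude r
        simp only [treesOf, Finset.mem_singleton, BinTree.magnitude, reduceCtorEq, false_iff]
        omega
    | n + 2 =>
      simp only [treesOf, Finset.mem_biUnion, Finset.mem_image, Finset.mem_product,
        Finset.mem_attach, true_and, Subtype.exists, Finset.mem_range, Prod.exists]
      constructor
      · rintro ⟨k, hk, l, r, ⟨hl, hr⟩, rfl⟩
        rw [ih _ (by omega)] at hl hr
        simp only [BinTree.magnitude]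
        omega
      · cases τ with
        | leaf => simp [BinTree.magnitude]
        | node l r =>
          intro h
          have := BinTree.one_le_magnitude l
          have := BinTree.one_le_magnitude r
          simp only [BinTree.magnitude] at h
          refine ⟨l.magnitude - 1, by omega, l, r, ⟨?_, ?_⟩, rfl⟩ <;>
            rw [ih _ (by omega)] <;> omega

lemma treesOf_nonempty (n : ℕ) : (treesOf (n + 1)).Nonempty := by
  induction n with
  | zero => exact ⟨.leaf, by simp [treesOf]⟩
  | succ n ih =>
    obtain ⟨τ, hτ⟩ := ih
    refine ⟨.node .leaf τ, ?_⟩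
    rw [mem_treesOf] at hτ ⊢
    simp only [BinTree.magnitude, hτ]
    omega

lemma sum_treesOf_add_two {M : Type*} [AddCommMonoid M] (n : ℕ) (f : BinTree → M) :
    ∑ τ ∈ treesOf (n + 2), f τ =
      ∑ p ∈ Finset.HasAntidiagonal.antidiagonal (n + 2),
        ∑ l ∈ treesOf p.1, ∑ r ∈ treesOf p.2, f (.node l r) := by
  simp_rw [← Finset.sum_product']
  rw [Finset.sum_sigma']
  symm
  refine Finset.sum_bij (fun q _ ↦ BinTree.node q.2.1 q.2.2) ?_ ?_ ?_ ?_
  · rintro ⟨⟨i, j⟩, l, r⟩ h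
    simp only [Finset.mem_sigma, Finset.HasAntidiagonal.mem_antidiagonal, Finset.mem_product, mem_treesOf,
      BinTree.magnitude] at h ⊢
    omega
  · rintro ⟨⟨i, j⟩, l, r⟩ h ⟨⟨i', j'⟩, l', r'⟩ h' heq
    simp only [Finset.mem_sigma, Finset.mem_product, mem_treesOf] at h h'
    obtain ⟨-, rfl, rfl⟩ := h
    obtain ⟨-, rfl, rfl⟩ := h'
    simp only [BinTree.node.injEq] at heq
    obtain ⟨rfl, rfl⟩ := heq
    rfl
  · intro τ h
    rw [mem_treesOf] at h
    cases τ with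
    | leaf => simp [BinTree.magnitude] at h
    | node l r =>
      refine ⟨⟨(l.magnitude, r.magnitude), l, r⟩, ?_, rfl⟩
      simpa [mem_treesOf, BinTree.magnitude] using h
  · intros
    rfl

section GeneratingFunction

open Polynomial

variable {R : Type*} [CommRing R]

/-- The polynomial enumerating the trees of magnitude `n` by their number of order-2 branches. -/
noncomputable def cherryPoly (R : Type*) [CommRing R] (n : ℕ) : R[X] :=
  ∑ τ ∈ treesOf n, X ^ BinTree.branches 2 τ

lemma cherryPoly_zero : cherryPoly R 0 = 0 := by simp [cherryPoly, treesOf]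

lemma cherryPoly_one : cherryPoly R 1 = 1 := by simp [cherryPoly, treesOf, BinTree.branches]

lemma cherryPoly_add_two (n : ℕ) :
    cherryPoly R (n + 2) =
      ∑ p ∈ Finset.HasAntidiagonal.antidiagonal (n + 2), cherryPoly R p.1 * cherryPoly R p.2 +
        if n = 0 then X - 1 else 0 := by
  have h : cherryPoly R (n + 2) =
      (if n = 0 then X else 1) *
        ∑ p ∈ Finset.HasAntidiagonal.antidiagonal (n + 2), cherryPoly R p.1 * cherryPoly R p.2 := by
    simp_rw [cherryPoly, Finset.sum_mul_sum, Finset.mul_sum]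
    rw [sum_treesOf_add_two]
    refine Finset.sum_congr rfl fun p hp ↦ Finset.sum_congr rfl fun l hl ↦
      Finset.sum_congr rfl fun r hr ↦ ?_
    rw [Finset.HasAntidiagonal.mem_antidiagonal] at hp
    rw [mem_treesOf] at hl hr
    rw [BinTree.branches_two_node, BinTree.magnitude, hl, hr, hp]
    by_cases hn : n = 0 <;> simp [hn, pow_add, mul_comm]
  rw [h]
  by_cases hn : n = 0
  · subst hn
    simp [Finset.Nat.antidiagonal_succ, cherryPoly_zero, cherryPoly_one]
  · simp [hn]

/-- The bivariate generating function of trees by magnitude and number of order-2 branches. -/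
noncomputable def cherrySeries (R : Type*) [CommRing R] : PowerSeries R[X] :=
  PowerSeries.mk (cherryPoly R)

lemma cherrySeries_eq :
    cherrySeries R = cherrySeries R ^ 2 + PowerSeries.X +
      PowerSeries.C (X - 1) * PowerSeries.X ^ 2 := by
  ext1 n
  match n with
  | 0 => simp [cherrySeries, cherryPoly_zero, pow_two]
  | 1 =>
    simp [cherrySeries, cherryPoly_zero, cherryPoly_one, pow_two, PowerSeries.coeff_mul,
      Finset.Nat.antidiagonal_succ, PowerSeries.coeff_X]
  | n + 2 =>
    rw [map_add, map_add, PowerSeries.coeff_C_mul, PowerSeries.coeff_X, PowerSeries.coeff_X_pow]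
    simp [cherrySeries, cherryPoly_add_two, pow_two, PowerSeries.coeff_mul]

/-- Coefficientwise differentiation of a power series over a polynomial ring. -/
noncomputable def coeffDeriv (R : Type*) [CommRing R] :
    Derivation R (PowerSeries R[X]) (PowerSeries R[X]) :=
  Derivation.mk'
    { toFun := fun f ↦ PowerSeries.mk fun n ↦ derivative (PowerSeries.coeff n f)
      map_add' := fun f g ↦ by ext1 n; simp
      map_smul' := fun a f ↦ by ext1 n; simp }
    fun f g ↦ by
      ext1 n
      simp only [LinearMap.coe_mk, AddHom.coe_mk, PowerSeries.coeff_mk, PowerSeries.coeff_mul,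
        smul_eq_mul, map_add, derivative_sum, derivative_mul, Finset.sum_add_distrib]
      rw [add_comm]
      congr 1
      rw [← Finset.Nat.sum_antidiagonal_swap]
      exact Finset.sum_congr rfl fun p _ ↦ by simp [mul_comm]

lemma coeff_coeffDeriv (n : ℕ) (f : PowerSeries R[X]) :
    PowerSeries.coeff n (coeffDeriv R f) = derivative (PowerSeries.coeff n f) := by
  simp [coeffDeriv]

/-- The derivation `x ∂ₓ - 2 u ∂ᵤ` on power series in `x` over polynomials in `u`. -/
noncomputable def eulerDeriv (R : Type*) [CommRing R] :
    Derivation R (PowerSeries R[X]) (PowerSeries R[X]) :=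
  Derivation.mk'
    { toFun := fun f ↦ PowerSeries.mk fun n ↦
        (n : R[X]) * PowerSeries.coeff n f - 2 * X * derivative (PowerSeries.coeff n f)
      map_add' := fun f g ↦ by ext1 n; simp; ring
      map_smul' := fun a f ↦ by ext1 n; simp [smul_sub] }
    fun f g ↦ by
      ext1 n
      simp only [LinearMap.coe_mk, AddHom.coe_mk, PowerSeries.coeff_mk, PowerSeries.coeff_mul,
        smul_eq_mul, map_add, derivative_sum, derivative_mul]
      rw [← Finset.Nat.sum_antidiagonal_swap (n := n) (f := fun p ↦ PowerSeries.coeff p.1 g * _),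
        ← Finset.sum_add_distrib, Finset.mul_sum, Finset.mul_sum, ← Finset.sum_sub_distrib]
      refine Finset.sum_congr rfl fun p hp ↦ ?_
      rw [← Finset.HasAntidiagonal.mem_antidiagonal.mp hp]
      simp only [Prod.fst_swap, Prod.snd_swap, Nat.cast_add]
      ring

lemma coeff_eulerDeriv (n : ℕ) (f : PowerSeries R[X]) :
    PowerSeries.coeff n (eulerDeriv R f) =
      (n : R[X]) * PowerSeries.coeff n f - 2 * X * derivative (PowerSeries.coeff n f) := by
  simp [eulerDeriv]

lemma coeffDeriv_X : coeffDeriv R PowerSeries.X = 0 := by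
  ext1 n
  rw [coeff_coeffDeriv, PowerSeries.coeff_X]
  split_ifs <;> simp

lemma coeffDeriv_C (p : R[X]) :
    coeffDeriv R (PowerSeries.C p) = PowerSeries.C (derivative p) := by
  ext1 n
  rw [coeff_coeffDeriv, PowerSeries.coeff_C, PowerSeries.coeff_C]
  split_ifs <;> simp

lemma eulerDeriv_X : eulerDeriv R PowerSeries.X = PowerSeries.X := by
  ext1 n
  rw [coeff_eulerDeriv, PowerSeries.coeff_X]
  split_ifs with h <;> simp [h]

lemma eulerDeriv_C (p : R[X]) :
    eulerDeriv R (PowerSeries.C p) = PowerSeries.C (-2 * X * derivative p) := by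
  ext1 n
  rw [coeff_eulerDeriv, PowerSeries.coeff_C, PowerSeries.coeff_C]
  split_ifs with h <;> simp [h]

lemma cherrySeries_pde [IsDomain R] [CharZero R] :
    eulerDeriv R (eulerDeriv R (cherrySeries R)) - eulerDeriv R (cherrySeries R) =
      4 * PowerSeries.C X * coeffDeriv R (coeffDeriv R (cherrySeries R)) := by
  set D := eulerDeriv R
  set U := coeffDeriv R
  set B := cherrySeries R with hB
  set x : PowerSeries R[X] := PowerSeries.X
  set u : PowerSeries R[X] := PowerSeries.C X with hu
  have hQ : (2 * B - 1) ^ 2 = 1 - 4 * x - 4 * (u - 1) * x ^ 2 := by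
    have h := cherrySeries_eq (R := R)
    rw [map_sub, map_one] at h
    linear_combination -4 * h
  have hDx : D x = x := eulerDeriv_X
  have hUx : U x = 0 := coeffDeriv_X
  have hDu : D u = -2 * u := by
    rw [hu, eulerDeriv_C, derivative_X, mul_one, map_mul, map_neg, map_ofNat]
  have hUu : U u = 1 := by
    rw [hu, coeffDeriv_C]; simp
  have ofNat_zero (E : Derivation R (PowerSeries R[X]) (PowerSeries R[X])) (k : ℕ)
      [k.AtLeastTwo] : E ofNat(k) = 0 := by
    rw [← Nat.cast_ofNat]; exact E.map_natCast k
  set V := 2 * B - 1 with hV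
  have hDV : D V = 2 * D B := by simp [hV, ofNat_zero]
  have hUV : U V = 2 * U B := by simp [hV, ofNat_zero]
  have hDDV : D (D V) = 2 * D (D B) := by rw [hDV]; simp [ofNat_zero]
  have hUUV : U (U V) = 2 * U (U B) := by rw [hUV]; simp [ofNat_zero]
  have h1 : 2 * V * D V = -4 * x + 8 * x ^ 2 := by
    have := congrArg D hQ
    simp [Derivation.leibniz_pow, ofNat_zero, hDx, hDu] at this
    linear_combination this
  have h2 : 2 * D V ^ 2 + 2 * V * D (D V) = -4 * x + 16 * x ^ 2 := by
    have := congrArg D h1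
    simp [Derivation.leibniz_pow, ofNat_zero, hDx] at this
    linear_combination this
  have h3 : 2 * V * U V = -4 * x ^ 2 := by
    have := congrArg U hQ
    simp [Derivation.leibniz_pow, ofNat_zero, hUx, hUu] at this
    linear_combination this
  have h4 : 2 * U V ^ 2 + 2 * V * U (U V) = 0 := by
    have := congrArg U h3
    simp [Derivation.leibniz_pow, ofNat_zero, hUx] at this
    linear_combination this
  have key : 16 * V ^ 3 * (D (D B) - D B - 4 * u * U (U B)) = 0 := by
    linear_combination 4 * V ^ 2 * h2 - 2 * (2 * V * D V + 8 * x ^ 2 - 4 * x) * h1 - 4 * V ^ 2 * h1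
      - 4 * u * (4 * V ^ 2 * h4 - 2 * (2 * V * U V - 4 * x ^ 2) * h3) + 32 * x ^ 2 * hQ
      - 8 * V ^ 3 * hDDV + 8 * V ^ 3 * hDV + 32 * u * V ^ 3 * hUUV
  have hV0 : V ≠ 0 := by
    intro h
    have := congrArg (PowerSeries.coeff 0) h
    simp [hV, hB, cherrySeries, cherryPoly_zero] at this
  have h16 : (16 : PowerSeries R[X]) ≠ 0 := by
    intro h
    have := congrArg PowerSeries.constantCoeff h
    rw [map_ofNat, map_zero] at this
    exact OfNat.ofNat_ne_zero 16 this
  exact sub_eq_zero.mp ((mul_eq_zero.mp key).resolve_left (mul_ne_zero h16 (pow_ne_zero 3 hV0)))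

lemma cherryPoly_ode [IsDomain R] [CharZero R] (n : ℕ) :
    (4 * (n : R[X]) - 6) * (X * derivative (cherryPoly R n)) -
        (n : R[X]) * ((n : R[X]) - 1) * cherryPoly R n =
      4 * (X * (X - 1) * derivative (derivative (cherryPoly R n))) := by
  have h := congrArg (PowerSeries.coeff n) (cherrySeries_pde (R := R))
  have h4 : (4 : PowerSeries R[X]) * PowerSeries.C X = PowerSeries.C (4 * X) := by
    rw [map_mul, map_ofNat]
  rw [h4, map_sub, PowerSeries.coeff_C_mul] at h
  simp only [coeff_eulerDeriv, coeff_coeffDeriv, cherrySeries, PowerSeries.coeff_mk] at h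
  simp [derivative_mul] at h
  linear_combination -h

/-- A Stein-type identity for the number of order-2 branches of the trees of magnitude `n`. -/
lemma sum_treesOf_stein [IsDomain R] [CharZero R] (n : ℕ) (g : ℕ → R) :
    ∑ τ ∈ treesOf n,
        ((4 * n - 6) * BinTree.branches 2 τ - n * (n - 1)) * g (BinTree.branches 2 τ) =
      ∑ τ ∈ treesOf n, 4 * (BinTree.branches 2 τ * (BinTree.branches 2 τ - 1) *
        (g (BinTree.branches 2 τ) - g (BinTree.branches 2 τ - 1))) := by
  set L : R[X] →ₗ[R] R := (Polynomial.basisMonomials R).constr R g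
  have hL (k : ℕ) : L (X ^ k) = g k := by
    have := (Polynomial.basisMonomials R).constr_basis R g k
    simpa only [Polynomial.coe_basisMonomials, monomial_one_right_eq_X_pow] using this
  have hCL (a : R) (p : R[X]) : L (C a * p) = a * L p := by
    rw [← smul_eq_C_mul, map_smul, smul_eq_mul]
  have h := congrArg L (cherryPoly_ode (R := R) n)
  rw [show (4 * (n : R[X]) - 6) = C (4 * (n : R) - 6) by
      rw [map_sub, map_mul, map_natCast, map_ofNat, map_ofNat],
    show ((n : R[X]) * ((n : R[X]) - 1)) = C ((n : R) * (n - 1)) by simp,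
    show (4 : R[X]) = C 4 from (map_ofNat C 4).symm, map_sub, hCL, hCL, hCL] at h
  simp only [cherryPoly, Finset.mul_sum, map_sum] at h
  rw [← Finset.sum_sub_distrib] at h
  refine (Finset.sum_congr rfl fun τ _ ↦ ?_).trans (h.trans (Finset.sum_congr rfl fun τ _ ↦ ?_))
  · generalize BinTree.branches 2 τ = k
    have : (X : R[X]) * derivative (X ^ k) = C (k : R) * X ^ k := by
      cases k with
      | zero => simp
      | succ k => simp; ring
    rw [this, hCL, hL]
    ring
  · generalize BinTree.branches 2 τ = k
    have : (X : R[X]) * (X - 1) * derivative (derivative (X ^ k)) =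
        C (k * (k - 1) : R) * (X ^ k - X ^ (k - 1)) := by
      match k with
      | 0 => simp
      | 1 => simp
      | k + 2 =>
        rw [derivative_X_pow, derivative_C_mul, derivative_X_pow]
        simp only [map_mul, map_sub, map_natCast, map_one, Nat.cast_add, Nat.cast_ofNat,
          Nat.cast_one, map_add, map_ofNat, Nat.add_succ_sub_one]
        ring
    rw [this, hCL, map_sub, hL, hL]

end GeneratingFunction

lemma sum_branches_two (n : ℕ) :
    (4 * n - 6) * ∑ τ ∈ treesOf n, (BinTree.branches 2 τ : ℝ) =
      n * (n - 1) * (treesOf n).card := by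
  have h := sum_treesOf_stein (R := ℝ) n fun _ ↦ 1
  simp only [mul_one, sub_self, mul_zero, Finset.sum_const_zero, Finset.sum_sub_distrib,
    Finset.sum_const, ← Finset.mul_sum, nsmul_eq_mul] at h
  linear_combination h

lemma sum_branches_two_sq (n : ℕ) :
    (4 * n - 10) * ∑ τ ∈ treesOf n, (BinTree.branches 2 τ : ℝ) ^ 2 =
      (n * (n - 1) - 4) * ∑ τ ∈ treesOf n, (BinTree.branches 2 τ : ℝ) := by
  have h := sum_treesOf_stein (R := ℝ) n fun k ↦ k
  have h' : ∑ τ ∈ treesOf n, 4 * ((BinTree.branches 2 τ : ℝ) * (BinTree.branches 2 τ - 1) *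
        (BinTree.branches 2 τ - (BinTree.branches 2 τ - 1 : ℕ))) =
      ∑ τ ∈ treesOf n, 4 * ((BinTree.branches 2 τ : ℝ) ^ 2 - BinTree.branches 2 τ) := by
    refine Finset.sum_congr rfl fun τ _ ↦ ?_
    cases BinTree.branches 2 τ with
    | zero => simp
    | succ k => simp; ring
  have h'' : ∑ τ ∈ treesOf n, ((4 * n - 6) * (BinTree.branches 2 τ : ℝ) - n * (n - 1)) *
        BinTree.branches 2 τ =
      ∑ τ ∈ treesOf n, ((4 * n - 6) * (BinTree.branches 2 τ : ℝ) ^ 2 -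
        n * (n - 1) * BinTree.branches 2 τ) :=
    Finset.sum_congr rfl fun τ _ ↦ by ring
  rw [h', h''] at h
  simp only [← Finset.mul_sum, Finset.sum_sub_distrib] at h
  linear_combination h

lemma sum_sq_sub_le {n : ℕ} (hn : 3 ≤ n) :
    ∑ τ ∈ treesOf n, (2 * (BinTree.branches 2 τ : ℝ) - n / 2) ^ 2 ≤
      ((treesOf n).card : ℝ) * (n : ℝ) := by
  have hn' : (3 : ℝ) ≤ n := by exact_mod_cast hn
  have h1 := sum_branches_two n
  have h2 := sum_branches_two_sq n
  have h : ∑ τ ∈ treesOf n, (2 * (BinTree.branches 2 τ : ℝ) - n / 2) ^ 2 =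
      4 * ∑ τ ∈ treesOf n, (BinTree.branches 2 τ : ℝ) ^ 2 -
        2 * n * ∑ τ ∈ treesOf n, (BinTree.branches 2 τ : ℝ) +
          ((treesOf n).card : ℝ) * ((n : ℝ) ^ 2 / 4) := by
    rw [Finset.mul_sum, Finset.mul_sum, ← Finset.sum_sub_distrib, ← nsmul_eq_mul,
      ← Finset.sum_const, ← Finset.sum_add_distrib]
    exact Finset.sum_congr rfl fun τ _ ↦ by ring
  have key : (4 * (n : ℝ) - 10) * (4 * n - 6) *
      ∑ τ ∈ treesOf n, (2 * (BinTree.branches 2 τ : ℝ) - n / 2) ^ 2 =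
        (treesOf n).card * n * (4 * n ^ 2 - 17 * n + 16) := by
    rw [h]
    linear_combination 4 * (4 * (n : ℝ) - 6) * h2 - 4 * ((n : ℝ) - 2) ^ 2 * h1
  have hpos : 0 < (4 * (n : ℝ) - 10) * (4 * n - 6) := by
    apply mul_pos <;> linarith
  refine le_of_mul_le_mul_left ?_ hpos
  rw [key, mul_comm _ (_ * (n : ℝ))]
  gcongr
  nlinarith

lemma sum_abs_sub_le {n : ℕ} (hn : 3 ≤ n) :
    ∑ τ ∈ treesOf n, |2 * (BinTree.branches 2 τ : ℝ) - n / 2| ≤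
      ((treesOf n).card : ℝ) * √(n : ℝ) := by
  have hpos : 0 < √(n : ℝ) := Real.sqrt_pos.mpr (by exact_mod_cast (by omega : 0 < n))
  have hsq : √(n : ℝ) ^ 2 = n := Real.sq_sqrt n.cast_nonneg
  have hle (a : ℝ) : 2 * √(n : ℝ) * |a| ≤ a ^ 2 + n := by
    nlinarith [sq_nonneg (|a| - √(n : ℝ)), sq_abs a]
  have h := Finset.sum_le_sum fun τ (_ : τ ∈ treesOf n) ↦
    hle (2 * (BinTree.branches 2 τ : ℝ) - n / 2)
  rw [← Finset.mul_sum, Finset.sum_add_distrib, Finset.sum_const, nsmul_eq_mul] at h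
  have h2 := sum_sq_sub_le hn
  refine le_of_mul_le_mul_left ?_ (mul_pos two_pos hpos)
  nlinarith

lemma branches_two_cast_le {n : ℕ} {τ : BinTree} (hτ : τ ∈ treesOf n) :
    (BinTree.branches 2 τ : ℝ) ≤ n := by
  rw [mem_treesOf] at hτ
  exact_mod_cast hτ ▸ BinTree.branches_two_le_magnitude τ

lemma sum_abs_quadratic_sub_le {n : ℕ} (hn : 3 ≤ n) :
    ∑ τ ∈ treesOf n,
        |4 * ((BinTree.branches 2 τ : ℝ) * (BinTree.branches 2 τ - 1)) - n ^ 2 / 4| ≤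
      ((treesOf n).card : ℝ) * (7 * n * √(n : ℝ)) := by
  have hsq : 1 ≤ √(n : ℝ) := Real.one_le_sqrt.mpr (by exact_mod_cast (by omega : 1 ≤ n))
  have hle : ∀ τ ∈ treesOf n,
      |4 * ((BinTree.branches 2 τ : ℝ) * (BinTree.branches 2 τ - 1)) - n ^ 2 / 4| ≤
        5 / 2 * n * |2 * (BinTree.branches 2 τ : ℝ) - n / 2| + 4 * n := by
    intro τ hτ
    have hk := branches_two_cast_le hτ
    have hk0 : (0 : ℝ) ≤ BinTree.branches 2 τ := Nat.cast_nonneg _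
    generalize (BinTree.branches 2 τ : ℝ) = k at hk hk0
    calc |4 * (k * (k - 1)) - (n : ℝ) ^ 2 / 4| = |(2 * k + n / 2) * (2 * k - n / 2) + -(4 * k)| := by
          ring_nf
      _ ≤ |(2 * k + n / 2) * (2 * k - n / 2)| + |-(4 * k)| := abs_add_le _ _
      _ = (2 * k + n / 2) * |2 * k - n / 2| + 4 * k := by
          rw [abs_mul, abs_neg, abs_of_nonneg (by positivity : 0 ≤ 2 * k + (n : ℝ) / 2),
            abs_of_nonneg (by positivity : 0 ≤ 4 * k)]
      _ ≤ _ := by gcongr; linarith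
  refine (Finset.sum_le_sum hle).trans ?_
  rw [Finset.sum_add_distrib, ← Finset.mul_sum, Finset.sum_const, nsmul_eq_mul]
  have h := mul_le_mul_of_nonneg_left (sum_abs_sub_le hn) (by positivity : 0 ≤ 5 / 2 * (n : ℝ))
  have h' : ((treesOf n).card : ℝ) * (4 * n) ≤ (treesOf n).card * (4 * n * √(n : ℝ)) :=
    mul_le_mul_of_nonneg_left (le_mul_of_one_le_right (by positivity) hsq) (by positivity)
  have : (0 : ℝ) ≤ (treesOf n).card * n * √(n : ℝ) := by positivity
  linarith

/-- The normalized number `√n (S₂ / n - 1/4)` of order-2 branches, as a function of `S₂`. -/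
noncomputable def normalizedCount (n k : ℕ) : ℝ := √n * ((k : ℝ) / n - 1 / 4)

/-- The unnormalized characteristic function of the normalized number of order-2 branches. -/
noncomputable def cherryCharSum (n : ℕ) (t : ℝ) : ℂ :=
  ∑ τ ∈ treesOf n, Complex.exp (t * normalizedCount n (BinTree.branches 2 τ) * Complex.I)

/-- The derivative of `cherryCharSum`. -/
noncomputable def cherryCharSumDeriv (n : ℕ) (t : ℝ) : ℂ :=
  ∑ τ ∈ treesOf n, normalizedCount n (BinTree.branches 2 τ) * Complex.I *
    Complex.exp (t * normalizedCount n (BinTree.branches 2 τ) * Complex.I)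

lemma hasDerivAt_cherryCharSum (n : ℕ) (t : ℝ) :
    HasDerivAt (cherryCharSum n) (cherryCharSumDeriv n t) t := by
  refine HasDerivAt.fun_sum fun τ _ ↦ ?_
  have h : HasDerivAt (fun t : ℝ ↦
      (t : ℂ) * normalizedCount n (BinTree.branches 2 τ) * Complex.I)
      (normalizedCount n (BinTree.branches 2 τ) * Complex.I) t := by
    simpa using! ((Complex.ofRealCLM.hasDerivAt (x := t)).mul_const
      (normalizedCount n (BinTree.branches 2 τ) : ℂ)).mul_const Complex.I
  simpa [mul_comm] using h.cexp

lemma cherryCharSum_zero (n : ℕ) : cherryCharSum n 0 = (treesOf n).card := by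
  simp [cherryCharSum]

lemma norm_exp_ofReal_mul_ofReal_mul_I (s x : ℝ) : ‖Complex.exp (s * x * Complex.I)‖ = 1 := by
  rw [← Complex.ofReal_mul, Complex.norm_exp_ofReal_mul_I]

lemma norm_sum_ofReal_mul_exp_le {T : Finset BinTree} (a x : BinTree → ℝ) (t : ℝ) :
    ‖∑ τ ∈ T, (a τ : ℂ) * Complex.exp (t * x τ * Complex.I)‖ ≤ ∑ τ ∈ T, |a τ| := by
  refine norm_sum_le_of_le _ fun τ _ ↦ ?_
  rw [norm_mul, norm_exp_ofReal_mul_ofReal_mul_I, mul_one, Complex.norm_real, Real.norm_eq_abs]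

lemma norm_cherryCharSumDeriv_add_le {n : ℕ} (hn : 3 ≤ n) {t : ℝ} (ht : t ^ 2 ≤ n) :
    ‖cherryCharSumDeriv n t + t / 16 * cherryCharSum n t‖ ≤
      ((treesOf n).card : ℝ) * ((2 * |t| + t ^ 2 + 2) / √(n : ℝ)) := by
  have hn0 : (0 : ℝ) < n := by exact_mod_cast (by omega : 0 < n)
  set r : ℝ := √(n : ℝ) with hr
  have hr0 : 0 < r := Real.sqrt_pos.mpr hn0
  have hr2 : r ^ 2 = n := Real.sq_sqrt hn0.le
  set s : ℝ := t / r with hs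
  have hts : t = s * r := by rw [hs]; field_simp
  have hs1 : |s| ≤ 1 := by
    rw [← sq_le_one_iff_abs_le_one, hs, div_pow, hr2]
    exact div_le_one_of_le₀ ht hn0.le
  set N : ℝ := ((treesOf n).card : ℝ)
  set w := Complex.exp (-s * Complex.I) with hw
  set e : BinTree → ℂ := fun τ ↦
    Complex.exp (t * normalizedCount n (BinTree.branches 2 τ) * Complex.I) with he
  have hrC : (r : ℂ) ^ 2 = n := by exact_mod_cast hr2
  have hrC0 : (r : ℂ) ≠ 0 := by exact_mod_cast hr0.ne'
  have hw1 : ‖1 - w‖ ≤ |s| := by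
    have := Real.norm_exp_I_mul_ofReal_sub_one_le (x := -s)
    rw [norm_neg, Real.norm_eq_abs] at this
    rw [norm_sub_rev, hw]
    simpa [mul_comm] using this
  have hw2 : ‖1 - w - s * Complex.I‖ ≤ s ^ 2 := by
    have := Complex.norm_exp_sub_one_sub_id_le (x := -s * Complex.I) (by simpa using hs1)
    rw [← norm_neg]
    simpa [hw, sub_eq_add_neg, add_comm, add_left_comm, add_assoc] using this
  have stein : ∑ τ ∈ treesOf n,
        ((4 * n - 6) * (BinTree.branches 2 τ : ℂ) - n * (n - 1)) * e τ =
      (1 - w) * ∑ τ ∈ treesOf n,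
        4 * ((BinTree.branches 2 τ : ℂ) * (BinTree.branches 2 τ - 1)) * e τ := by
    have h := sum_treesOf_stein (R := ℂ) n fun k ↦
      Complex.exp (t * normalizedCount n k * Complex.I)
    rw [h, Finset.mul_sum]
    refine Finset.sum_congr rfl fun τ _ ↦ ?_
    simp only [he]
    cases BinTree.branches 2 τ with
    | zero => simp
    | succ k =>
      have : Complex.exp (t * normalizedCount n k * Complex.I) =
          w * Complex.exp (t * normalizedCount n (k + 1) * Complex.I) := by
        rw [hw, ← Complex.exp_add]
        congr 1
        simp only [normalizedCount, hts]
        push_cast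
        rw [← hr, ← hrC]
        field_simp
        ring
      rw [Nat.add_sub_cancel, this]
      ring
  have key : (4 * n * r) * (cherryCharSumDeriv n t + t / 16 * cherryCharSum n t) =
      Complex.I * ((1 - w) * ∑ τ ∈ treesOf n,
          ((4 * ((BinTree.branches 2 τ : ℝ) * (BinTree.branches 2 τ - 1)) - n ^ 2 / 4 : ℝ) : ℂ) *
            e τ +
        n ^ 2 / 4 * (1 - w - s * Complex.I) * ∑ τ ∈ treesOf n, ((1 : ℝ) : ℂ) * e τ +
        ∑ τ ∈ treesOf n, ((6 * (BinTree.branches 2 τ : ℝ) - n : ℝ) : ℂ) * e τ) := by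
    have hD : (4 * n * r) * cherryCharSumDeriv n t = Complex.I *
        (∑ τ ∈ treesOf n, ((4 * n - 6) * (BinTree.branches 2 τ : ℂ) - n * (n - 1)) * e τ +
          ∑ τ ∈ treesOf n, (6 * (BinTree.branches 2 τ : ℂ) - n) * e τ) := by
      rw [cherryCharSumDeriv, ← Finset.sum_add_distrib, Finset.mul_sum, Finset.mul_sum]
      refine Finset.sum_congr rfl fun τ _ ↦ ?_
      have : (4 * n * r) * (normalizedCount n (BinTree.branches 2 τ) : ℂ) =
          4 * n * BinTree.branches 2 τ - n ^ 2 := by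
        simp only [normalizedCount]
        push_cast
        rw [← hr, ← hrC]
        field_simp
      linear_combination Complex.I * e τ * this
    have hS : cherryCharSum n t = ∑ τ ∈ treesOf n, e τ := rfl
    have h1 : ∑ τ ∈ treesOf n,
          ((4 * ((BinTree.branches 2 τ : ℝ) * (BinTree.branches 2 τ - 1)) - n ^ 2 / 4 : ℝ) : ℂ) *
            e τ =
        ∑ τ ∈ treesOf n, 4 * ((BinTree.branches 2 τ : ℂ) * (BinTree.branches 2 τ - 1)) * e τ -
          n ^ 2 / 4 * ∑ τ ∈ treesOf n, e τ := by
      rw [Finset.mul_sum, ← Finset.sum_sub_distrib]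
      exact Finset.sum_congr rfl fun τ _ ↦ by push_cast; ring
    have ht' : (t : ℂ) = s * r := by exact_mod_cast hts
    rw [mul_add, hD, stein, h1, hS, ht']
    push_cast
    simp only [one_mul]
    linear_combination (n * s / 4 * ∑ τ ∈ treesOf n, e τ) * hrC +
      (n ^ 2 / 4 * s * ∑ τ ∈ treesOf n, e τ) * Complex.I_mul_I
  have b1 := (norm_sum_ofReal_mul_exp_le (T := treesOf n)
    (fun τ ↦ 4 * ((BinTree.branches 2 τ : ℝ) * (BinTree.branches 2 τ - 1)) - n ^ 2 / 4)
    (fun τ ↦ normalizedCount n (BinTree.branches 2 τ)) t).trans (sum_abs_quadratic_sub_le hn)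
  have b2 := norm_sum_ofReal_mul_exp_le (T := treesOf n) (fun _ ↦ 1)
    (fun τ ↦ normalizedCount n (BinTree.branches 2 τ)) t
  rw [abs_one, Finset.sum_const, nsmul_eq_mul, mul_one] at b2
  have b3 : ‖∑ τ ∈ treesOf n, ((6 * (BinTree.branches 2 τ : ℝ) - n : ℝ) : ℂ) * e τ‖ ≤
      N * (6 * n) := by
    refine (norm_sum_ofReal_mul_exp_le (fun τ ↦ 6 * (BinTree.branches 2 τ : ℝ) - n)
      (fun τ ↦ normalizedCount n (BinTree.branches 2 τ)) t).trans ?_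
    rw [← nsmul_eq_mul]
    refine Finset.sum_le_card_nsmul _ _ _ fun τ hτ ↦ ?_
    have hk := branches_two_cast_le hτ
    have hk0 : (0 : ℝ) ≤ BinTree.branches 2 τ := Nat.cast_nonneg _
    rw [abs_le]
    constructor <;> linarith
  have hc : 0 < 4 * n * r := by positivity
  have hN : 0 ≤ N := Nat.cast_nonneg _
  refine le_of_mul_le_mul_left ?_ hc
  calc 4 * n * r * ‖cherryCharSumDeriv n t + t / 16 * cherryCharSum n t‖
      = ‖(4 * n * r : ℂ) * (cherryCharSumDeriv n t + t / 16 * cherryCharSum n t)‖ := by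
        rw [norm_mul]
        congr 1
        have : (4 * n * r : ℂ) = ((4 * n * r : ℝ) : ℂ) := by push_cast; rfl
        rw [this, Complex.norm_real, Real.norm_of_nonneg hc.le]
    _ ≤ |s| * (N * (7 * n * r)) + n ^ 2 / 4 * s ^ 2 * N + N * (6 * n) := by
        rw [key, norm_mul, Complex.norm_I, one_mul]
        refine (norm_add₃_le).trans ?_
        rw [norm_mul, norm_mul, norm_mul]
        have : ‖(n ^ 2 / 4 : ℂ)‖ = (n : ℝ) ^ 2 / 4 := by simp
        rw [this]
        gcongr
    _ = N * n * (7 * |t| + t ^ 2 / 4 + 6) := by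
        rw [hs, abs_div, abs_of_pos hr0, div_pow, hr2]
        have h1 : |t| / r * r = |t| := div_mul_cancel₀ _ hr0.ne'
        have h2 : t ^ 2 / n * n = t ^ 2 := div_mul_cancel₀ _ hn0.ne'
        linear_combination 7 * N * n * h1 + N * n / 4 * h2
    _ ≤ N * n * (4 * (2 * |t| + t ^ 2 + 2)) := by
        refine mul_le_mul_of_nonneg_left ?_ (mul_nonneg hN hn0.le)
        linarith [abs_nonneg t, sq_nonneg t]
    _ = 4 * n * r * (N * ((2 * |t| + t ^ 2 + 2) / r)) := by
        have h : (2 * |t| + t ^ 2 + 2) / r * r = 2 * |t| + t ^ 2 + 2 := div_mul_cancel₀ _ hr0.ne'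
        linear_combination -(4 * N * n) * h

lemma norm_cherryCharSum_sub_le {n : ℕ} (hn : 3 ≤ n) {t : ℝ} (ht : t ^ 2 ≤ n) :
    ‖cherryCharSum n t * Complex.exp (t ^ 2 / 32) - (treesOf n).card‖ ≤
      ((treesOf n).card : ℝ) * ((2 * |t| + t ^ 2 + 2) / √(n : ℝ)) * Real.exp (t ^ 2 / 32) * |t| := by
  have hderiv (y : ℝ) : HasDerivAt
      (fun y : ℝ ↦ cherryCharSum n y * Complex.exp (y ^ 2 / 32))
      ((cherryCharSumDeriv n y + y / 16 * cherryCharSum n y) * Complex.exp (y ^ 2 / 32)) y := by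
    have h : HasDerivAt (fun y : ℝ ↦ (y : ℂ) ^ 2 / 32) ((y : ℂ) / 16) y := by
      have := ((Complex.ofRealCLM.hasDerivAt (x := y)).pow 2).div_const 32
      convert! this using 1
      simp
      ring
    convert! (hasDerivAt_cherryCharSum n y).mul h.cexp using 1
    ring
  have bound : ∀ y ∈ Set.uIcc 0 t,
      ‖(cherryCharSumDeriv n y + y / 16 * cherryCharSum n y) * Complex.exp (y ^ 2 / 32)‖ ≤
        ((treesOf n).card : ℝ) * ((2 * |t| + t ^ 2 + 2) / √(n : ℝ)) * Real.exp (t ^ 2 / 32) := by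
    intro y hy
    have hyt : |y| ≤ |t| := by simpa using Set.abs_sub_left_of_mem_uIcc hy
    have hyt2 : y ^ 2 ≤ t ^ 2 := sq_le_sq.mpr hyt
    have : (y ^ 2 / 32 : ℂ) = ((y ^ 2 / 32 : ℝ) : ℂ) := by push_cast; rfl
    rw [norm_mul, this, Complex.norm_exp_ofReal]
    gcongr
    refine (norm_cherryCharSumDeriv_add_le hn (hyt2.trans ht)).trans ?_
    gcongr
  have := Convex.norm_image_sub_le_of_norm_hasDerivWithin_le
    (fun y _ ↦ (hderiv y).hasDerivWithinAt) bound (convex_uIcc 0 t) Set.left_mem_uIcc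
    Set.right_mem_uIcc
  simpa [cherryCharSum_zero] using this

lemma tendsto_cherryCharSum_div (t : ℝ) :
    Tendsto (fun n ↦ cherryCharSum n t / (treesOf n).card) atTop
      (𝓝 (Complex.exp (-(t ^ 2 / 32)))) := by
  have key : Tendsto (fun n ↦ cherryCharSum n t / (treesOf n).card * Complex.exp (t ^ 2 / 32))
      atTop (𝓝 1) := by
    rw [tendsto_iff_norm_sub_tendsto_zero]
    have hlim : Tendsto (fun n : ℕ ↦ (2 * |t| + t ^ 2 + 2) / √(n : ℝ) * Real.exp (t ^ 2 / 32) * |t|)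
        atTop (𝓝 0) := by
      have : Tendsto (fun n : ℕ ↦ (2 * |t| + t ^ 2 + 2) / √(n : ℝ)) atTop (𝓝 0) :=
        tendsto_const_nhds.div_atTop (Real.tendsto_sqrt_atTop.comp tendsto_natCast_atTop_atTop)
      simpa using (this.mul_const (Real.exp (t ^ 2 / 32))).mul_const |t|
    refine squeeze_zero' (.of_forall fun _ ↦ norm_nonneg _) ?_ hlim
    filter_upwards [eventually_ge_atTop 3, eventually_ge_atTop ⌈t ^ 2⌉₊] with n hn hnt
    have hN : (0 : ℝ) < (treesOf n).card := by
      obtain ⟨m, rfl⟩ : ∃ m, n = m + 1 := ⟨n - 1, by omega⟩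
      exact_mod_cast (treesOf_nonempty m).card_pos
    have hNC : ((treesOf n).card : ℂ) ≠ 0 := by exact_mod_cast hN.ne'
    refine le_of_mul_le_mul_left ?_ hN
    have h := norm_cherryCharSum_sub_le hn (Nat.ceil_le.mp hnt)
    calc _ = ‖((treesOf n).card : ℂ) *
          (cherryCharSum n t / (treesOf n).card * Complex.exp (t ^ 2 / 32) - 1)‖ := by
          rw [norm_mul, Complex.norm_natCast]
      _ = ‖cherryCharSum n t * Complex.exp (t ^ 2 / 32) - (treesOf n).card‖ := by
          congr 1
          field_simp
      _ ≤ _ := h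
      _ = _ := by ring
  have := key.mul_const (Complex.exp (-(t ^ 2 / 32)))
  rw [one_mul] at this
  refine this.congr fun n ↦ ?_
  rw [mul_assoc, ← Complex.exp_add, add_neg_cancel, Complex.exp_zero, mul_one]

/-- The law of the normalized number of order-2 branches on the random model. -/
noncomputable def cherryLaw (n : ℕ) : Measure ℝ :=
  ((treesOf n).card : ENNReal)⁻¹ •
    ∑ τ ∈ treesOf n, Measure.dirac (normalizedCount n (BinTree.branches 2 τ))

lemma isProbabilityMeasure_cherryLaw (n : ℕ) : IsProbabilityMeasure (cherryLaw (n + 1)) := by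
  constructor
  have h : ((treesOf (n + 1)).card : ENNReal) ≠ 0 := by
    exact_mod_cast (treesOf_nonempty n).card_pos.ne'
  simp [cherryLaw, ENNReal.inv_mul_cancel h]

lemma integral_cherryLaw {E : Type*} [NormedAddCommGroup E] [NormedSpace ℝ E] [CompleteSpace E]
    (n : ℕ) (f : ℝ → E) :
    ∫ x, f x ∂(cherryLaw n) =
      ((treesOf n).card : ℝ)⁻¹ •
        ∑ τ ∈ treesOf n, f (normalizedCount n (BinTree.branches 2 τ)) := by
  rw [cherryLaw, integral_smul_measure, integral_finsetSum_measure]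
  · simp
  · exact fun τ _ ↦ integrable_dirac (by simp)

lemma charFun_cherryLaw (n : ℕ) (t : ℝ) :
    charFun (cherryLaw n) t = cherryCharSum n t / (treesOf n).card := by
  rw [charFun_apply_real, integral_cherryLaw, cherryCharSum, div_eq_inv_mul]
  simp

/-- Wang–Waymire: `√n (S_{2,n}/n − 1/4)` converges in distribution to `N(0, 1/16)`.
Convergence in distribution is stated via bounded continuous test functions. -/
theorem clt_lowest_bifurcation_ratio :
    ∀ f : BoundedContinuousFunction ℝ ℝ,
      Tendsto (fun n : ℕ => expect n (fun τ =>
          f (Real.sqrt n * ((BinTree.branches 2 τ : ℝ) / n - 1/4))))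
        atTop (𝓝 (∫ x, f x ∂(gaussianReal 0 (1/16)))) := by
  intro f
  rw [← tendsto_add_atTop_iff_nat 1]
  let μ (n : ℕ) : ProbabilityMeasure ℝ := ⟨cherryLaw (n + 1), isProbabilityMeasure_cherryLaw n⟩
  let ν : ProbabilityMeasure ℝ := ⟨gaussianReal 0 (1 / 16), inferInstance⟩
  have h : Tendsto μ atTop (𝓝 ν) := by
    rw [ProbabilityMeasure.tendsto_iff_tendsto_charFun]
    intro t
    have := (tendsto_add_atTop_iff_nat 1).mpr (tendsto_cherryCharSum_div t)
    simp only [μ, ν, ProbabilityMeasure.coe_mk, charFun_cherryLaw, charFun_gaussianReal]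
    convert! this using 3
    push_cast
    ring
  have := ProbabilityMeasure.tendsto_iff_forall_integral_tendsto.mp h f
  refine this.congr fun n ↦ ?_
  simp only [μ, ProbabilityMeasure.coe_mk, integral_cherryLaw, expect, normalizedCount,
    smul_eq_mul, div_eq_inv_mul]
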